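/- arXiv:1712.06110 — 3 statements merged into one kernel-verified Lean document; each statement's English description precedes it below -/
import Mathlib

section
/- Let d ≥ 2, let X ⊆ ℝ^d be an open set homeomorphic to ℝ^d, and let ψ : X → X be continuous, injective, and run-away. Then there exists a relatively compact open exhaustion (X_n)_{n ∈ ℕ} of X (i.e. each X_n is open with compact closure contained in X, X_n ⊆ X_{n+1} for all n, and ∪_{n} X_n = X) such that: (1) for every n ∈ ℕ there exists m ≥ 1 with X_n ∩ ψ^m(X_n) = ∅; and (2) whenever m, n ∈ ℕ are such that X_n ∩ ψ^m(X_n) = ∅, and X \ (X_n ∪ ψ^m(X_n)) = F ∪ K with F ∩ K = ∅, F relatively closed in X, and K ⊆ X compact, then K = ∅. -/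
/-- The run-away property. -/
def RunAway {X : Type*} [TopologicalSpace X] (ψ : X → X) : Prop :=
  ∀ K : Set X, IsCompact K → ∃ m : ℕ, 1 ≤ m ∧ (ψ^[m] '' K) ∩ K = ∅

open Set Metric MeasureTheory Topology

lemma LinearMap.exists_det_one_add_eq_sum {E : Type*} [AddCommGroup E] [Module ℝ E]
    [FiniteDimensional ℝ E] (S : Finset ℝ) (hS : Module.finrank ℝ E < S.card) :
    ∃ c : ℝ → ℝ, ∀ A : E →ₗ[ℝ] E,
      LinearMap.det (1 + A) = ∑ t ∈ S, c t * LinearMap.det ((1 : E →ₗ[ℝ] E) + t • A) := by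
  refine ⟨fun t => (Lagrange.basis S _root_.id t).eval 1, fun A => ?_⟩
  let b := Module.finBasis ℝ E
  let M := LinearMap.toMatrix b b A
  let P : Polynomial ℝ := Matrix.det ((Polynomial.X : Polynomial ℝ) • M.map Polynomial.C
    + (1 : Matrix _ _ ℝ).map Polynomial.C)
  have hP : ∀ t : ℝ, P.eval t = LinearMap.det ((1 : E →ₗ[ℝ] E) + t • A) := by
    intro t
    rw [← LinearMap.det_toMatrix b, map_add, map_smul, LinearMap.toMatrix_one]
    simp only [P, ← Polynomial.coe_evalRingHom, RingHom.map_det]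
    congr 1
    ext i j
    rcases eq_or_ne i j with rfl | hij
    · simp [M, add_comm, mul_comm t]
    · simp [M, Matrix.one_apply_ne hij, mul_comm t]
  have hdeg : P.degree < S.card := by
    refine (Polynomial.degree_le_of_natDegree_le
      (Polynomial.natDegree_det_X_add_C_le M 1)).trans_lt ?_
    rw [Fintype.card_fin]
    exact_mod_cast hS
  have h := congrArg (Polynomial.eval 1)
    (Lagrange.eq_interpolate (s := S) (v := _root_.id) (injOn_id _) hdeg)
  rw [hP, one_smul, Lagrange.interpolate_apply, Polynomial.eval_finsetSum] at h
  rw [h]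
  refine Finset.sum_congr rfl fun t _ => ?_
  simp [hP, mul_comm]

lemma ContinuousLinearMap.det_one_add_pos {E : Type*} [NormedAddCommGroup E] [NormedSpace ℝ E]
    [FiniteDimensional ℝ E] (L : E →L[ℝ] E) (hL : ‖L‖ < 1) :
    0 < (1 + L).det := by
  have hne : ∀ s ∈ Icc (0 : ℝ) 1, (1 + s • L).det ≠ 0 := by
    intro s hs h0
    obtain ⟨v, hv, hv0⟩ := Submodule.exists_mem_ne_zero_of_ne_bot
      (LinearMap.bot_lt_ker_of_det_eq_zero h0).ne'
    have hv' : v + s • L v = 0 := by simpa using hv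
    have h1 : ‖v‖ = ‖s • L v‖ := by
      rw [← norm_neg (s • L v), ← eq_neg_of_add_eq_zero_left hv']
    have h2 : ‖s • L v‖ ≤ ‖L‖ * ‖v‖ := by
      rw [norm_smul, Real.norm_of_nonneg hs.1]
      nlinarith [L.le_opNorm v, norm_nonneg (L v), hs.2]
    nlinarith [norm_pos_iff.2 hv0]
  have hcont : ContinuousOn (fun s : ℝ => (1 + s • L).det) (Icc 0 1) := by
    refine (ContinuousLinearMap.continuous_det.comp ?_).continuousOn
    fun_prop
  by_contra hneg
  push Not at hneg
  have := intermediate_value_Icc' zero_le_one hcont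
  obtain ⟨s, hs, h0⟩ := this (show (0 : ℝ) ∈ _ from ⟨by simpa using hneg, by
    simp [ContinuousLinearMap.det]⟩)
  exact hne s hs h0

lemma LipschitzWith.bijective_add_self {E : Type*} [NormedAddCommGroup E] [CompleteSpace E]
    {g : E → E} {K : NNReal} (hK : K < 1) (hg : LipschitzWith K g) :
    Function.Bijective (fun x => x + g x) := by
  constructor
  · intro x y hxy
    have h1 : x - y = g y - g x := by
      have : x + g x = y + g y := hxy
      rw [sub_eq_sub_iff_add_eq_add, this, add_comm]
    have h2 := hg.dist_le_mul y x
    rw [dist_eq_norm, ← h1, dist_comm, dist_eq_norm] at h2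
    by_contra hne
    have : (0 : ℝ) < ‖x - y‖ := norm_pos_iff.2 (sub_ne_zero.2 hne)
    have hK' : (K : ℝ) < 1 := hK
    nlinarith
  · intro y
    have hc : ContractingWith K (fun x => y - g x) := by
      refine ⟨hK, LipschitzWith.of_dist_le_mul fun a b => ?_⟩
      rw [dist_sub_left]
      exact hg.dist_le_mul a b
    refine ⟨hc.fixedPoint, ?_⟩
    have h : y - g hc.fixedPoint = hc.fixedPoint := hc.fixedPoint_isFixedPt
    exact (sub_eq_iff_eq_add.1 h).symm

lemma Function.Bijective.image_eq_of_forall_notMem {α : Type*} {f : α → α}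
    (hf : Function.Bijective f) {s : Set α} (hs : ∀ x ∉ s, f x = x) : f '' s = s := by
  ext y
  constructor
  · rintro ⟨x, hx, rfl⟩
    by_contra h
    exact h ((hf.1 (hs _ h)).symm ▸ hx)
  · intro hy
    obtain ⟨x, rfl⟩ := hf.2 y
    refine ⟨x, ?_, rfl⟩
    by_contra h
    exact h (hs x h ▸ hy)

/-- A map that is Lipschitz on a closed ball and vanishes on its boundary sphere is still Lipschitz
when extended by zero. -/
lemma LipschitzOnWith.piecewise_closedBall_zero {E : Type*} [NormedAddCommGroup E]
    [NormedSpace ℝ E] {g : E → E} {K : NNReal} {r : ℝ}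
    (hg : LipschitzOnWith K g (closedBall 0 r)) (h0 : ∀ x, ‖x‖ = r → g x = 0) :
    LipschitzWith K (fun x => open Classical in if x ∈ closedBall (0 : E) r then g x else 0) := by
  classical
  have key : ∀ x y : E, x ∈ closedBall (0 : E) r → y ∉ closedBall (0 : E) r →
      dist (g x) 0 ≤ K * dist x y := by
    intro x y hx hy
    rw [mem_closedBall_zero_iff] at hx hy
    have hc : ContinuousOn (fun t : ℝ => ‖AffineMap.lineMap x y t‖) (Icc 0 1) := by
      fun_prop
    obtain ⟨t, ht, hz⟩ := intermediate_value_Icc zero_le_one hc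
      (show r ∈ _ from ⟨by simpa using hx, by simpa using (not_le.1 hy).le⟩)
    have h1 := hg.dist_le_mul x (mem_closedBall_zero_iff.2 hx) (AffineMap.lineMap x y t)
      (mem_closedBall_zero_iff.2 hz.le)
    rw [h0 _ hz] at h1
    refine h1.trans ?_
    gcongr
    rw [dist_left_lineMap, Real.norm_of_nonneg ht.1]
    exact mul_le_of_le_one_left dist_nonneg ht.2
  refine LipschitzWith.of_dist_le_mul fun x y => ?_
  by_cases hx : x ∈ closedBall (0 : E) r <;> by_cases hy : y ∈ closedBall (0 : E) r
  · simpa [hx, hy] using hg.dist_le_mul x hx y hy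
  · simpa only [hx, hy, if_true, if_false] using key x y hx hy
  · simpa only [hx, hy, if_true, if_false, dist_comm] using key y x hy hx
  · simp only [hx, hy, if_false, dist_self]
    positivity

lemma ContinuousLinearMap.det_eq_zero_of_norm_eq_const {E : Type*} [NormedAddCommGroup E]
    [InnerProductSpace ℝ E] [FiniteDimensional ℝ E] {f : E → E} {f' : E →L[ℝ] E} {x : E} {r : ℝ}
    (hr : 0 < r) (hf : HasFDerivAt f f' x) (hn : ∀ y, ‖f y‖ = r) : f'.det = 0 := by
  by_contra hdet
  have hconst : HasFDerivAt (fun y => ‖f y‖ ^ 2) (0 : E →L[ℝ] ℝ) x := by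
    simp only [hn]
    exact hasFDerivAt_const _ _
  have heq := hf.norm_sq.unique hconst
  let e := LinearMap.equivOfDetNeZero (f' : E →ₗ[ℝ] E) hdet
  have h1 := congrArg (fun L => L (e.symm (f x))) heq
  have h2 : f' (e.symm (f x)) = f x := e.apply_symm_apply (f x)
  simp [h2, hn] at h1
  exact hr.ne' h1

lemma exists_lipschitzOnWith_closedBall_of_contDiff {E : Type*} [NormedAddCommGroup E]
    [NormedSpace ℝ E] [FiniteDimensional ℝ E] {g : E → E} (hg : ContDiff ℝ 1 g) (r : ℝ) :
    ∃ K, LipschitzOnWith K g (closedBall 0 r) := by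
  have hc : Continuous (fderiv ℝ g) := hg.continuous_fderiv one_ne_zero
  obtain ⟨C, hC⟩ := (isCompact_closedBall (0 : E) r).exists_bound_of_continuousOn hc.continuousOn
  refine ⟨C.toNNReal, (convex_closedBall 0 r).lipschitzOnWith_of_nnnorm_fderiv_le
    (fun x _ => (hg.differentiable one_ne_zero) x) fun x hx => ?_⟩
  rw [← NNReal.coe_le_coe]
  exact (hC x hx).trans (Real.le_coe_toNNReal C)

lemma setIntegral_det_one_add_smul_fderiv {E : Type*} [NormedAddCommGroup E]
    [NormedSpace ℝ E] [FiniteDimensional ℝ E] [MeasurableSpace E] [BorelSpace E]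
    (μ : Measure E) [μ.IsAddHaarMeasure] {g : E → E} {K : NNReal} {r t : ℝ}
    (hd : Differentiable ℝ g) (hg : LipschitzOnWith K g (closedBall 0 r))
    (h0 : ∀ x, ‖x‖ = r → g x = 0) (ht : 0 ≤ t) (htK : t * K < 1) :
    ∫ x in ball 0 r, (1 + t • fderiv ℝ g x).det ∂μ = μ.real (ball 0 r) := by
  classical
  set G : E → E := fun x => if x ∈ closedBall (0 : E) r then g x else 0 with hG
  have hGL : LipschitzWith K G := by
    convert hg.piecewise_closedBall_zero h0
  have htL : LipschitzWith (t.toNNReal * K) (fun x => t • G x) := by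
    refine LipschitzWith.of_dist_le_mul fun x y => ?_
    rw [dist_smul₀, Real.norm_of_nonneg ht, NNReal.coe_mul, Real.coe_toNNReal _ ht, mul_assoc]
    exact mul_le_mul_of_nonneg_left (hGL.dist_le_mul x y) ht
  have hbij := htL.bijective_add_self (by
    rw [← NNReal.coe_lt_coe, NNReal.coe_mul, Real.coe_toNNReal _ ht]; exact_mod_cast htK)
  have himg : (fun x => x + t • G x) '' ball 0 r = ball 0 r := by
    refine hbij.image_eq_of_forall_notMem fun x hx => ?_
    have hGx : G x = 0 := by
      by_cases hx' : x ∈ closedBall (0 : E) r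
      · rw [mem_ball_zero_iff, not_lt] at hx
        simp only [hG, hx', if_true]
        exact h0 x (le_antisymm (mem_closedBall_zero_iff.1 hx') hx)
      · simp only [hG, hx', if_false]
    simp [hGx]
  have hGd : ∀ x ∈ ball (0 : E) r, HasFDerivAt G (fderiv ℝ g x) x := by
    intro x hx
    refine (hd x).hasFDerivAt.congr_of_eventuallyEq ?_
    filter_upwards [isOpen_ball.mem_nhds hx] with y hy
    simp only [hG, ball_subset_closedBall hy, if_true]
  have hfd : ∀ x ∈ ball (0 : E) r, HasFDerivWithinAt (fun x => x + t • G x)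
      (1 + t • fderiv ℝ g x) (ball 0 r) x := fun x hx =>
    ((hasFDerivAt_id x).add ((hGd x hx).const_smul t)).hasFDerivWithinAt
  have hcov := integral_image_eq_integral_abs_det_fderiv_smul μ measurableSet_ball hfd
    hbij.1.injOn (fun _ => (1 : ℝ))
  rw [himg] at hcov
  simp only [smul_eq_mul, mul_one, integral_const, measureReal_restrict_apply_univ] at hcov
  rw [hcov]
  refine setIntegral_congr_fun measurableSet_ball fun x hx => ?_
  refine (abs_of_pos (ContinuousLinearMap.det_one_add_pos _ ?_)).symm
  rw [norm_smul, Real.norm_of_nonneg ht]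
  exact (mul_le_mul_of_nonneg_left ((hGd x hx).le_of_lipschitz hGL) ht).trans_lt htK

/-- There is no `C¹` retraction of a ball onto its boundary sphere. -/
lemma not_contDiff_retraction_sphere {E : Type*} [NormedAddCommGroup E] [InnerProductSpace ℝ E]
    [FiniteDimensional ℝ E] {R : E → E} {r : ℝ} (hr : 0 < r) (hR : ContDiff ℝ 1 R)
    (hn : ∀ x, ‖R x‖ = r) (hid : ∀ x, ‖x‖ = r → R x = x) : False := by
  let : MeasurableSpace E := borel E
  have : BorelSpace E := ⟨rfl⟩
  set g : E → E := fun x => R x - x with hg_def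
  have hg : ContDiff ℝ 1 g := hR.sub contDiff_id
  obtain ⟨K, hK⟩ := exists_lipschitzOnWith_closedBall_of_contDiff hg r
  let τ : ℕ → ℝ := fun j => 1 / (K + 1 + j)
  have hτpos : ∀ j : ℕ, (0 : ℝ) < K + 1 + j := fun j => by positivity
  have hτinj : Function.Injective τ := by
    intro i j hij
    have : (K : ℝ) + 1 + i = K + 1 + j := by simpa [τ] using hij
    exact_mod_cast add_left_cancel this
  let S : Finset ℝ := (Finset.range (Module.finrank ℝ E + 1)).image τ
  obtain ⟨c, hc⟩ := LinearMap.exists_det_one_add_eq_sum (E := E) S (by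
    rw [Finset.card_image_of_injective _ hτinj, Finset.card_range]; exact Nat.lt_succ_self _)
  have hint : ∀ t ∈ S, ∫ x in ball 0 r, (1 + t • fderiv ℝ g x).det =
      volume.real (ball (0 : E) r) := by
    intro t ht
    obtain ⟨j, -, rfl⟩ := Finset.mem_image.1 ht
    refine setIntegral_det_one_add_smul_fderiv volume (hg.differentiable one_ne_zero) hK
      (fun x hx => ?_) (one_div_pos.2 (hτpos j)).le ?_
    · simp [g, hid x hx]
    · rw [one_div_mul_eq_div, div_lt_one (hτpos j)]
      have : (0 : ℝ) ≤ j := by positivity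
      linarith
  have hc1 : ∑ t ∈ S, c t = 1 := by simpa using (hc 0).symm
  have hpt : ∀ x, (1 + fderiv ℝ g x).det = ∑ t ∈ S, c t * (1 + t • fderiv ℝ g x).det :=
    fun x => hc (fderiv ℝ g x)
  have hzero : ∀ x, (1 + fderiv ℝ g x).det = 0 := by
    intro x
    have hd := (hR.differentiable one_ne_zero x).hasFDerivAt
    have : fderiv ℝ g x = fderiv ℝ R x - 1 := (hd.sub (hasFDerivAt_id x)).fderiv
    rw [this, add_sub_cancel]
    exact ContinuousLinearMap.det_eq_zero_of_norm_eq_const hr hd hn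
  have hi : ∀ t ∈ S, IntegrableOn (fun x => c t * (1 + t • fderiv ℝ g x).det) (ball 0 r) := by
    intro t _
    have hcont : Continuous fun x => c t * (1 + t • fderiv ℝ g x).det := by
      have := hg.continuous_fderiv one_ne_zero
      refine continuous_const.mul (ContinuousLinearMap.continuous_det.comp ?_)
      fun_prop
    exact (hcont.continuousOn.integrableOn_compact (isCompact_closedBall 0 r)).mono_set
      ball_subset_closedBall
  have key : ∫ x in ball (0 : E) r, (1 + fderiv ℝ g x).det = volume.real (ball (0 : E) r) := by
    simp_rw [hpt]
    rw [integral_finsetSum _ hi]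
    simp_rw [integral_const_mul]
    rw [Finset.sum_congr rfl fun t ht => by rw [hint t ht], ← Finset.sum_mul, hc1, one_mul]
  simp only [hzero, integral_zero] at key
  exact (ENNReal.toReal_pos (measure_ball_pos volume (0 : E) hr).ne' measure_ball_lt_top.ne).ne key

/-- A continuous self-map of Euclidean space that is the identity near infinity is surjective. -/
lemma Continuous.surjective_of_eq_id_of_le_norm {E : Type*} [NormedAddCommGroup E]
    [InnerProductSpace ℝ E] [FiniteDimensional ℝ E] {h : E → E} (hc : Continuous h) {ρ : ℝ}
    (hid : ∀ x, ρ ≤ ‖x‖ → h x = x) : Function.Surjective h := by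
  intro p
  by_contra! hp
  let k : E → E := fun x => h (x + p) - p
  have hk : Continuous k := by fun_prop
  have hk0 : ∀ x, k x ≠ 0 := fun x => sub_ne_zero.2 (hp _)
  set r₀ := max 0 (ρ + ‖p‖)
  have hkid : ∀ x, r₀ ≤ ‖x‖ → k x = x := by
    intro x hx
    have h1 : ρ ≤ ‖x + p‖ := by
      have h2 : ‖x‖ ≤ ‖x + p‖ + ‖p‖ := by simpa using norm_sub_le (x + p) p
      linarith [(le_max_right _ _).trans hx]
    simp [k, hid _ h1]
  have hr₀ : 0 ≤ r₀ := le_max_left _ _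
  obtain ⟨g, hg, hgk, hgS, -⟩ := hk.exists_contDiff_approx_and_eqOn 1 hk.norm
    (fun x => norm_pos_iff.2 (hk0 x)) (S := {x | r₀ + 1 ≤ ‖x‖}) (U := {x | r₀ < ‖x‖})
    (isClosed_le continuous_const continuous_norm)
    ((isOpen_lt continuous_const continuous_norm).mem_nhdsSet.2 fun x hx => by
      simp only [mem_ofPred_eq] at hx ⊢; linarith)
    (contDiff_id.contDiffOn.congr fun x hx => hkid x (le_of_lt hx))
  have hg0 : ∀ x, g x ≠ 0 := by
    intro x h0
    have := hgk x
    rw [h0, dist_zero_left] at this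
    exact lt_irrefl _ this
  have hr : 0 < r₀ + 1 := by linarith
  refine not_contDiff_retraction_sphere (R := fun x => ((r₀ + 1) / ‖g x‖) • g x) hr ?_ ?_ ?_
  · have hg' : ContDiff ℝ 1 g := by exact_mod_cast hg
    exact (contDiff_const.div (hg'.norm ℝ hg0) fun x => norm_ne_zero_iff.2 (hg0 x)).smul hg'
  · intro x
    have := norm_ne_zero_iff.2 (hg0 x)
    rw [norm_smul, norm_div, norm_norm, Real.norm_of_nonneg hr.le, div_mul_cancel₀ _ this]
  · intro x hx
    have h1 : g x = x := (hgS hx.ge).trans (hkid x (by linarith))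
    simp only [h1, hx]
    rw [div_self hr.ne', one_smul]

/-- A continuous map moving no point of a closed ball by more than its radius hits the center. -/
lemma exists_mem_closedBall_eq_of_dist_le {E : Type*} [NormedAddCommGroup E]
    [InnerProductSpace ℝ E] [FiniteDimensional ℝ E] {G : E → E} {b : E} {ρ : ℝ} (hρ : 0 < ρ)
    (hG : ContinuousOn G (closedBall b ρ)) (hd : ∀ x ∈ closedBall b ρ, dist (G x) x ≤ ρ) :
    ∃ x ∈ closedBall b ρ, G x = b := by
  have := Metric.instTietzeExtensionClosedBall ℝ (0 : E) hρ
  let u : C(closedBall b ρ, closedBall (0 : E) ρ) :=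
    ⟨fun x => ⟨G x - x, by simpa [dist_eq_norm] using hd x x.2⟩, by
      have h := hG.domRestrict
      exact Continuous.subtype_mk (h.sub continuous_subtype_val) _⟩
  obtain ⟨U, hU⟩ := u.exists_restrict_eq isClosed_closedBall
  have hUG : ∀ x ∈ closedBall b ρ, (U x : E) = G x - x := fun x hx =>
    congrArg Subtype.val (DFunLike.congr_fun hU ⟨x, hx⟩)
  have hUn : ∀ x, ‖(U x : E)‖ ≤ ρ := fun x => mem_closedBall_zero_iff.1 (U x).2
  let η : E → ℝ := fun x => max 0 (min 1 (2 - ‖x - b‖ / ρ))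
  have hη0 : ∀ x, 0 ≤ η x := fun x => le_max_left _ _
  have hη1 : ∀ x, η x ≤ 1 := fun x => max_le zero_le_one (min_le_left _ _)
  let F : E → E := fun x => x + η x • (U x : E)
  have hF : Continuous F := by
    have h : Continuous fun x => (U x : E) := continuous_subtype_val.comp U.continuous
    fun_prop
  obtain ⟨x, hx⟩ := hF.surjective_of_eq_id_of_le_norm (ρ := ‖b‖ + 2 * ρ) (fun x hx => by
    have h1 : 2 * ρ ≤ ‖x - b‖ := by linarith [norm_sub_norm_le x b]
    have h2 : η x = 0 := by
      refine max_eq_left ((min_le_right _ _).trans ?_)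
      rw [sub_nonpos, le_div_iff₀ hρ]
      exact h1
    simp [F, h2]) b
  have hxb : x ∈ closedBall b ρ := by
    rw [mem_closedBall, dist_eq_norm]
    have h1 : x - b = -(η x • (U x : E)) := by
      rw [← hx]; simp [F]
    rw [h1, norm_neg, norm_smul, Real.norm_of_nonneg (hη0 x)]
    nlinarith [hUn x, hη0 x, hη1 x, norm_nonneg (U x : E)]
  refine ⟨x, hxb, ?_⟩
  have h1 : η x = 1 := by
    have : ‖x - b‖ / ρ ≤ 1 := by
      rw [div_le_one hρ, ← dist_eq_norm]
      exact hxb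
    simp only [η]
    rw [min_eq_left (by linarith), max_eq_right zero_le_one]
  rw [← hx]
  simp [F, h1, hUG x hxb]

lemma IsCompact.continuousOn_invFun_image {X Y : Type*} [TopologicalSpace X] [TopologicalSpace Y]
    [T2Space Y] [Nonempty X] {f : X → Y} (hf : Continuous f) (hinj : Function.Injective f)
    {s : Set X} (hs : IsCompact s) : ContinuousOn (Function.invFun f) (f '' s) := by
  refine continuousOn_iff_isClosed.2 fun t ht => ⟨f '' (s ∩ t),
    ((hs.inter_right ht).image hf).isClosed, ?_⟩
  ext y
  constructor
  · rintro ⟨h, x, hx, rfl⟩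
    rw [mem_preimage, Function.leftInverse_invFun hinj x] at h
    exact ⟨⟨x, ⟨hx, h⟩, rfl⟩, x, hx, rfl⟩
  · rintro ⟨⟨x, ⟨hx, hxt⟩, rfl⟩, h⟩
    refine ⟨?_, h⟩
    rwa [mem_preimage, Function.leftInverse_invFun hinj x]

lemma disjoint_image_ball_closedBall {E : Type*} [NormedAddCommGroup E]
    [InnerProductSpace ℝ E] [FiniteDimensional ℝ E] {φ : E → E} (hφ : Continuous φ)
    (hinj : Function.Injective φ) {R : ℝ} (hR : 0 < R)
    (hdisj : Disjoint (ball 0 R) (φ '' ball 0 R)) (hopen : IsOpen (ball 0 R ∪ φ '' ball 0 R)) :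
    Disjoint (φ '' ball 0 R) (closedBall 0 R) := by
  rw [Set.disjoint_left]
  rintro _ ⟨b, hb, rfl⟩ hvR
  have hout : ∀ x ∈ ball (0 : E) R, R ≤ ‖φ x‖ := by
    intro x hx
    by_contra h
    exact Set.disjoint_left.1 hdisj (mem_ball_zero_iff.2 (not_le.1 h)) (mem_image_of_mem φ hx)
  obtain ⟨δ, hδ, hδW⟩ := Metric.isOpen_iff.1 hopen _ (Or.inr (mem_image_of_mem φ hb))
  have hnear : ∀ᶠ x in 𝓝 b, x ∈ ball (0 : E) R ∧ φ x ∈ ball (φ b) (δ / 2) :=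
    (isOpen_ball.eventually_mem hb).and
      (hφ.continuousAt.eventually_mem (ball_mem_nhds _ (half_pos hδ)))
  obtain ⟨ρ, hρ, hρb⟩ := Metric.nhds_basis_closedBall.eventually_iff.1 hnear
  have hcinv := IsCompact.continuousOn_invFun_image hφ hinj (isCompact_closedBall (0 : E) R)
  have huc := ((isCompact_closedBall (0 : E) R).image hφ).uniformContinuousOn_of_continuous hcinv
  obtain ⟨δ', hδ', huc⟩ := Metric.uniformContinuousOn_iff.1 huc ρ hρ
  let M := R + δ
  have hM : 0 < M := by positivity
  obtain ⟨t, ht, htlt⟩ : ∃ t : ℝ, 0 < t ∧ t * M < min (δ / 2) δ' := by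
    have hm : 0 < min (δ / 2) δ' := lt_min (half_pos hδ) hδ'
    refine ⟨min (δ / 2) δ' / 2 / M, by positivity, ?_⟩
    rw [div_mul_cancel₀ _ hM.ne']
    exact half_lt_self hm
  have hmove : ∀ x ∈ closedBall b ρ, dist (φ x) ((1 + t) • φ x) < min (δ / 2) δ' := by
    intro x hx
    have h1 : ‖φ x‖ ≤ M := by
      have h2 := (hρb hx).2
      rw [mem_ball, dist_eq_norm] at h2
      have h3 := norm_sub_norm_le (φ x) (φ b)
      have h4 := mem_closedBall_zero_iff.1 hvR
      simp only [M]
      linarith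
    rw [add_smul, one_smul, dist_self_add_right, norm_smul, Real.norm_of_nonneg ht.le]
    exact (mul_le_mul_of_nonneg_left h1 ht.le).trans_lt htlt
  have hgrow : ∀ x ∈ ball (0 : E) R, R < ‖(1 + t) • φ x‖ := by
    intro x hx
    rw [norm_smul, Real.norm_of_nonneg (by linarith)]
    nlinarith [hout x hx]
  have hmem : ∀ x ∈ closedBall b ρ, (1 + t) • φ x ∈ φ '' ball 0 R := by
    intro x hx
    have h1 : (1 + t) • φ x ∈ ball (φ b) δ := by
      have h2 := (hρb hx).2
      rw [mem_ball] at h2 ⊢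
      have h3 := (hmove x hx).trans_le (min_le_left _ _)
      rw [dist_comm] at h3
      linarith [dist_triangle ((1 + t) • φ x) (φ x) (φ b)]
    refine (hδW h1).resolve_left fun h => ?_
    exact (mem_ball_zero_iff.1 h).not_gt (hgrow x (hρb hx).1)
  have hsub := image_mono (f := φ) (ball_subset_closedBall (x := (0 : E)) (ε := R))
  obtain ⟨x, hx, hxb⟩ := exists_mem_closedBall_eq_of_dist_le
    (G := fun x => Function.invFun φ ((1 + t) • φ x)) hρ
    (hcinv.comp (by fun_prop) fun x hx => hsub (hmem x hx)) (fun x hx => by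
      have h1 := huc (φ x) (hsub (mem_image_of_mem φ (hρb hx).1)) _ (hsub (hmem x hx))
        ((hmove x hx).trans_le (min_le_right _ _))
      rw [Function.leftInverse_invFun hinj x, dist_comm] at h1
      exact h1.le)
  obtain ⟨z, hz, hzx⟩ := hmem x hx
  simp only [← hzx, Function.leftInverse_invFun hinj z] at hxb
  have h1 := hgrow x (hρb hx).1
  rw [← hzx, hxb] at h1
  exact (mem_closedBall_zero_iff.1 hvR).not_gt h1

lemma ContinuousMap.homotopic_of_contractibleSpace {X Y : Type*} [TopologicalSpace X]
    [TopologicalSpace Y] [ContractibleSpace X] [PathConnectedSpace Y] (f g : C(X, Y)) :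
    f.Homotopic g := by
  obtain ⟨x, hx⟩ := id_nullhomotopic X
  have key : ∀ f : C(X, Y), f.Homotopic (ContinuousMap.const X (f x)) := fun f =>
    ContinuousMap.Homotopic.comp (.refl f) hx
  have : Nonempty X := ⟨x⟩
  exact (key f).trans ((ContinuousMap.homotopic_const_iff.2
    (PathConnectedSpace.joined (f x) (g x))).trans (key g).symm)

lemma ContinuousOn.ite_mem_union_of_isOpen {X Y : Type*} [TopologicalSpace X] [TopologicalSpace Y]
    {U V : Set X} [DecidablePred (· ∈ U)] (hU : IsOpen U) (hV : IsOpen V) (hd : Disjoint U V)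
    {a b : X → Y} (ha : ContinuousOn a U) (hb : ContinuousOn b V) :
    ContinuousOn (fun x => if x ∈ U then a x else b x) (U ∪ V) :=
  (ha.congr fun _ hx => if_pos hx).union_of_isOpen
    (hb.congr fun _ hx => if_neg (Set.disjoint_right.1 hd hx)) hU hV

/-- The complement of an open ball together with a disjoint injective continuous image of it has no
nonempty compact relatively clopen subset. -/
lemma eq_empty_of_compl_ball_union_image_eq {E : Type*} [NormedAddCommGroup E]
    [InnerProductSpace ℝ E] [FiniteDimensional ℝ E] (hE : 1 < Module.rank ℝ E) {φ : E → E}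
    (hφ : Continuous φ) (hinj : Function.Injective φ) {R : ℝ} (hR : 0 < R)
    (hdisj : Disjoint (ball 0 R) (φ '' ball 0 R)) {F K : Set E} (hF : IsClosed F)
    (hK : IsCompact K) (hFK : Disjoint F K) (h : (ball 0 R ∪ φ '' ball 0 R)ᶜ = F ∪ K) :
    K = ∅ := by
  classical
  by_contra hne
  obtain ⟨p, hp⟩ := Set.nonempty_iff_ne_empty.2 hne
  set B : Set E := ball 0 R
  set V : Set E := φ '' B
  have hW : IsOpen (B ∪ V) := by
    rw [← isClosed_compl_iff, h]
    exact hF.union hK.isClosed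
  have hVopen : IsOpen V := by
    have h1 := disjoint_image_ball_closedBall hφ hinj hR hdisj hW
    have h2 : V = (B ∪ V) \ closedBall 0 R := by
      ext x
      constructor
      · exact fun hx => ⟨Or.inr hx, Set.disjoint_left.1 h1 hx⟩
      · rintro ⟨hx | hx, hx'⟩
        · exact absurd (ball_subset_closedBall hx) hx'
        · exact hx
    rw [h2]
    exact hW.sdiff isClosed_closedBall
  have hpW : p ∉ B ∪ V := by
    rw [← mem_compl_iff, h]
    exact Or.inr hp
  obtain ⟨L, hL, hKL, hLF⟩ := exists_compact_between hK hF.isOpen_compl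
    hFK.symm.subset_compl_right
  have hfr : frontier L ⊆ B ∪ V := by
    intro x hx
    by_contra hx'
    rw [← mem_compl_iff, h] at hx'
    rcases hx' with hx' | hx'
    · exact hLF (hL.isClosed.frontier_subset hx) hx'
    · exact hx.2 (hKL hx')
  have hinvV : ContinuousOn (Function.invFun φ) V :=
    (IsCompact.continuousOn_invFun_image hφ hinj (isCompact_closedBall (0 : E) R)).mono
      (image_mono ball_subset_closedBall)
  have hinvB : ∀ x ∈ V, Function.invFun φ x ∈ B := by
    rintro _ ⟨z, hz, rfl⟩
    rwa [Function.leftInverse_invFun hinj z]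
  have := Metric.instTietzeExtensionBall (𝕜 := ℝ) (E := E) hR
  have hσ : ∀ x : frontier L, (if (x : E) ∈ B then (x : E) else Function.invFun φ x) ∈ B := by
    intro x
    split_ifs with hx
    · exact hx
    · exact hinvB _ ((hfr x.2).resolve_left hx)
  let s₀ : C(frontier L, B) :=
    ⟨fun x => ⟨if (x : E) ∈ B then x else Function.invFun φ x, hσ x⟩,
      Continuous.subtype_mk ((continuousOn_id.ite_mem_union_of_isOpen isOpen_ball hVopen hdisj
        hinvV).mono hfr).domRestrict hσ⟩
  obtain ⟨s, hs⟩ := s₀.exists_restrict_eq isClosed_frontier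
  let l₀ : C(frontier L, unitInterval) := ⟨fun x => if (x : E) ∈ B then 0 else 1,
    ((continuousOn_const (c := (0 : unitInterval))).ite_mem_union_of_isOpen
      isOpen_ball hVopen hdisj (continuousOn_const (c := 1))).mono hfr |>.domRestrict⟩
  obtain ⟨l, hl⟩ := l₀.exists_restrict_eq isClosed_frontier
  have hs' : ∀ x ∈ frontier L, (s x : E) = if x ∈ B then x else Function.invFun φ x :=
    fun x hx => congrArg Subtype.val (DFunLike.congr_fun hs ⟨x, hx⟩)
  have hl' : ∀ x ∈ frontier L, l x = if x ∈ B then 0 else 1 :=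
    fun x hx => DFunLike.congr_fun hl ⟨x, hx⟩
  have : ContractibleSpace B := (convex_ball (0 : E) R).contractibleSpace ⟨0, mem_ball_self hR⟩
  have : PathConnectedSpace ({p}ᶜ : Set E) :=
    isPathConnected_iff_pathConnectedSpace.1 (isPathConnected_compl_singleton_of_one_lt_rank hE p)
  let i : C(B, ({p}ᶜ : Set E)) := ⟨fun x => ⟨x, by
    rintro hx
    exact hpW (Or.inl (hx ▸ x.2))⟩, by fun_prop⟩
  let j : C(B, ({p}ᶜ : Set E)) := ⟨fun x => ⟨φ x, by
    rintro hx
    exact hpW (Or.inr (hx ▸ mem_image_of_mem φ x.2))⟩, by fun_prop⟩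
  obtain ⟨H⟩ := ContinuousMap.homotopic_of_contractibleSpace i j
  let g : E → E := fun x => (H (l x, s x) : E)
  have hg : Continuous g := by fun_prop
  have hgid : ∀ x ∈ frontier L, g x = x := by
    intro x hx
    have hsx := hs' x hx
    have hlx := hl' x hx
    simp only [g]
    by_cases hxB : x ∈ B
    · rw [if_pos hxB] at hsx hlx
      rw [hlx, H.apply_zero]
      exact hsx
    · rw [if_neg hxB] at hsx hlx
      rw [hlx, H.apply_one]
      change φ (s x) = x
      rw [hsx]
      obtain ⟨z, -, rfl⟩ := (hfr hx).resolve_left hxB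
      rw [Function.leftInverse_invFun hinj z]
  have hG : Continuous (L.piecewise g id) := hg.piecewise hgid continuous_id
  obtain ⟨ρ, hρ⟩ := hL.isBounded.exists_norm_le
  obtain ⟨x, hx⟩ := hG.surjective_of_eq_id_of_le_norm (ρ := ρ + 1) (fun x hx => by
    have : x ∉ L := fun hxL => by linarith [hρ x hxL]
    simp [this]) p
  by_cases hxL : x ∈ L
  · rw [piecewise_eq_of_mem _ _ _ hxL] at hx
    exact (H (l x, s x)).2 hx
  · rw [piecewise_eq_of_notMem _ _ _ hxL] at hx
    rw [id_eq] at hx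
    rw [hx] at hxL
    exact hxL (interior_subset (hKL hp))

/-- for `X ⊆ ℝ^d` (`d ≥ 2`) open and homeomorphic to `ℝ^d`, and
`ψ : X → X` continuous, injective and run-away, there is a relatively compact open
exhaustion `(Xₙ)` of `X` such that for every `n` there is `m ≥ 1` with
`Xₙ ∩ ψ^m(Xₙ) = ∅`, and, whenever `Xₙ ∩ ψ^m(Xₙ) = ∅` and `X \ (Xₙ ∪ ψ^m(Xₙ))` is the
disjoint union of a relatively closed set `F` and a compact set `K`, then `K = ∅`. -/
theorem stmt12 (d : ℕ) (hd : 2 ≤ d)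
    (X : Set (EuclideanSpace ℝ (Fin d))) (hXopen : IsOpen X)
    (hhomeo : Nonempty (↥X ≃ₜ EuclideanSpace ℝ (Fin d)))
    (ψ : ↥X → ↥X) (hc : Continuous ψ) (hinj : Function.Injective ψ)
    (hrun : RunAway ψ) :
    ∃ Xn : ℕ → Set ↥X,
      (∀ n, IsOpen (Xn n)) ∧
      (∀ n, IsCompact (closure (Xn n))) ∧
      (∀ n, Xn n ⊆ Xn (n + 1)) ∧
      (⋃ n, Xn n) = Set.univ ∧
      (∀ n, ∃ m : ℕ, 1 ≤ m ∧ Xn n ∩ (ψ^[m] '' Xn n) = ∅) ∧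
      (∀ n m : ℕ, Xn n ∩ (ψ^[m] '' Xn n) = ∅ →
        ∀ F K : Set ↥X, IsClosed F → IsCompact K → F ∩ K = ∅ →
          (Xn n ∪ ψ^[m] '' Xn n)ᶜ = F ∪ K → K = ∅) := by
  obtain ⟨h⟩ := hhomeo
  let Y : ℕ → Set X := fun n => h ⁻¹' ball 0 (n + 1)
  have hsub : ∀ n, Y n ⊆ h ⁻¹' closedBall 0 (n + 1) := fun n =>
    preimage_mono ball_subset_closedBall
  have hcpt : ∀ n : ℕ, IsCompact (h ⁻¹' closedBall 0 (n + 1)) := fun n =>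
    h.isCompact_preimage.2 (isCompact_closedBall _ _)
  refine ⟨Y, fun n => isOpen_ball.preimage h.continuous,
    fun n => (hcpt n).closure_of_subset (hsub n),
    fun n => preimage_mono (ball_subset_ball (by push_cast; linarith)), ?_, fun n => ?_, ?_⟩
  · refine eq_univ_of_forall fun x => mem_iUnion.2 ?_
    obtain ⟨n, hn⟩ := exists_nat_gt ‖h x‖
    exact ⟨n, mem_ball_zero_iff.2 (by linarith)⟩
  · obtain ⟨m, hm, hmK⟩ := hrun _ (hcpt n)
    refine ⟨m, hm, subset_empty_iff.1 ?_⟩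
    rw [← hmK, inter_comm]
    exact inter_subset_inter (image_mono (hsub n)) (hsub n)
  · intro n m hdisj F K hF hK hFK hcompl
    have hY : h '' Y n = ball 0 (n + 1) := h.image_preimage _
    have hφ : (h ∘ ψ^[m] ∘ h.symm) '' ball 0 (n + 1) = h '' (ψ^[m] '' Y n) := by
      rw [image_comp, image_comp, h.image_symm]
    refine image_eq_empty.1 (eq_empty_of_compl_ball_union_image_eq (φ := h ∘ ψ^[m] ∘ h.symm)
      (R := n + 1) (F := h '' F) (K := h '' K) ?_
      (h.continuous.comp ((hc.iterate m).comp h.symm.continuous))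
      (h.injective.comp ((hinj.iterate m).comp h.symm.injective)) (by positivity) ?_
      (h.isClosed_image.2 hF) (hK.image h.continuous) ?_ ?_)
    · rw [← Module.finrank_eq_rank, finrank_euclideanSpace_fin]
      exact_mod_cast hd
    · rw [hφ, ← hY, disjoint_image_iff h.injective, disjoint_iff_inter_eq_empty]
      exact hdisj
    · rw [disjoint_image_iff h.injective, disjoint_iff_inter_eq_empty]
      exact hFK
    · rw [hφ, ← hY, ← image_union, ← image_union, ← image_compl_eq h.bijective, hcompl]
end

section
/- Let λ ∈ ℂ, let X ⊆ ℂ ≅ ℝ² be open, and let w : X → ℂ and ψ : X → X be smooth (infinitely real-differentiable). Then the following are equivalent: (i) for every smooth f : X → ℂ with ∂_z̄ f = λ f on X, the function w·(f∘ψ) also satisfies ∂_z̄(w·(f∘ψ)) = λ·w·(f∘ψ) on X; (ii) w·∂_z̄ψ = 0 on X and ∂_z̄ w − λ w = −λ·w·∂_z̄ψ̄ on X. Moreover, if (i) holds, then for every open Y ⊆ X and every smooth f : Y → ℂ one has, on ψ^{-1}(Y): ∂_z̄(w·(f∘ψ)) − λ·w·(f∘ψ) = ∂_z̄ψ̄ ·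 w·((∂_z̄ f − λ f)∘ψ). -/
/-- The Wirtinger derivative `∂_z̄ u = (1/2)(∂₁u + i ∂₂u)` of a function `u : ℂ → ℂ`,
where `ℂ` is identified with `ℝ²` via `z = x₁ + i x₂`. -/
noncomputable def dbar (u : ℂ → ℂ) : ℂ → ℂ :=
  fun z => (1 / 2 : ℂ) * (fderiv ℝ u z 1 + Complex.I * fderiv ℝ u z Complex.I)

/-- The Wirtinger derivative `∂_z u = (1/2)(∂₁u - i ∂₂u)`. -/
noncomputable def dz (u : ℂ → ℂ) : ℂ → ℂ :=
  fun z => (1 / 2 : ℂ) * (fderiv ℝ u z 1 - Complex.I * fderiv ℝ u z Complex.I)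

lemma fderiv_eq_dz_add_dbar (u : ℂ → ℂ) (z v : ℂ) :
    fderiv ℝ u z v = dz u z * v + dbar u z * (starRingEnd ℂ) v := by
  have hv : v = v.re • (1 : ℂ) + v.im • Complex.I := by
    simp [Complex.re_add_im]
  have hd : fderiv ℝ u z v = v.re * fderiv ℝ u z 1 + v.im * fderiv ℝ u z Complex.I := by
    conv_lhs => rw [hv]
    rw [map_add, map_smul, map_smul, Complex.real_smul, Complex.real_smul]
  have hc : (starRingEnd ℂ) v = v.re - v.im * Complex.I := by
    apply Complex.ext <;> simp
  have hr : v = v.re + v.im * Complex.I := (Complex.re_add_im v).symm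
  rw [hd, hc, dz, dbar]
  conv_rhs => enter [1, 2]; rw [hr]
  linear_combination (v.im : ℂ) * fderiv ℝ u z Complex.I * Complex.I_mul_I

lemma dbar_conj {u : ℂ → ℂ} {z : ℂ} (hu : DifferentiableAt ℝ u z) :
    dbar (fun y => (starRingEnd ℂ) (u y)) z = (starRingEnd ℂ) (dz u z) := by
  have h : fderiv ℝ (fun y => (starRingEnd ℂ) (u y)) z
      = (Complex.conjCLE : ℂ →L[ℝ] ℂ).comp (fderiv ℝ u z) :=
    ((Complex.conjCLE : ℂ →L[ℝ] ℂ).hasFDerivAt.comp z hu.hasFDerivAt).fderiv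
  simp [dbar, dz, h, map_ofNat (starRingEnd ℂ) 2]

lemma dbar_mul {u v : ℂ → ℂ} {z : ℂ} (hu : DifferentiableAt ℝ u z)
    (hv : DifferentiableAt ℝ v z) :
    dbar (fun y => u y * v y) z = dbar u z * v z + u z * dbar v z := by
  simp only [dbar, fderiv_fun_mul hu hv, add_apply,
    smul_apply, smul_eq_mul]
  ring

lemma dbar_comp {f ψ : ℂ → ℂ} {z : ℂ} (hf : DifferentiableAt ℝ f (ψ z))
    (hψ : DifferentiableAt ℝ ψ z) :
    dbar (fun y => f (ψ y)) z = dz f (ψ z) * dbar ψ z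
      + dbar f (ψ z) * dbar (fun y => (starRingEnd ℂ) (ψ y)) z := by
  have h : fderiv ℝ (fun y => f (ψ y)) z = (fderiv ℝ f (ψ z)).comp (fderiv ℝ ψ z) :=
    (hf.hasFDerivAt.comp z hψ.hasFDerivAt).fderiv
  rw [dbar_conj hψ]
  unfold dbar
  rw [h, ContinuousLinearMap.comp_apply, ContinuousLinearMap.comp_apply,
    fderiv_eq_dz_add_dbar f (ψ z) (fderiv ℝ ψ z 1),
    fderiv_eq_dz_add_dbar f (ψ z) (fderiv ℝ ψ z Complex.I)]
  simp only [dz, dbar, map_mul, map_sub, map_div₀, map_one, map_ofNat, Complex.conj_I]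
  ring

lemma dbar_mul_comp {w f ψ : ℂ → ℂ} {z : ℂ} (hw : DifferentiableAt ℝ w z)
    (hf : DifferentiableAt ℝ f (ψ z)) (hψ : DifferentiableAt ℝ ψ z) :
    dbar (fun y => w y * f (ψ y)) z = dbar w z * f (ψ z)
      + w z * (dz f (ψ z) * dbar ψ z
        + dbar f (ψ z) * dbar (fun y => (starRingEnd ℂ) (ψ y)) z) := by
  rw [dbar_mul (v := fun y => f (ψ y)) hw (hf.comp z hψ), dbar_comp hf hψ]

lemma dbar_mul_comp_sub {w f ψ : ℂ → ℂ} {z lam : ℂ} (hw : DifferentiableAt ℝ w z)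
    (hf : DifferentiableAt ℝ f (ψ z)) (hψ : DifferentiableAt ℝ ψ z)
    (h₁ : w z * dbar ψ z = 0)
    (h₂ : dbar w z - lam * w z = -lam * w z * dbar (fun y => (starRingEnd ℂ) (ψ y)) z) :
    dbar (fun y => w y * f (ψ y)) z - lam * (w z * f (ψ z))
      = dbar (fun y => (starRingEnd ℂ) (ψ y)) z * (w z * (dbar f (ψ z) - lam * f (ψ z))) := by
  rw [dbar_mul_comp hw hf hψ]
  linear_combination dz f (ψ z) * h₁ + f (ψ z) * h₂

lemma hasFDerivAt_exp_mul_conj (lam z : ℂ) :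
    HasFDerivAt (fun y => Complex.exp (lam * (starRingEnd ℂ) y))
      (Complex.exp (lam * (starRingEnd ℂ) z) • (lam • (Complex.conjCLE : ℂ →L[ℝ] ℂ))) z :=
  (((Complex.conjCLE : ℂ →L[ℝ] ℂ).hasFDerivAt (x := z)).const_mul lam).cexp

lemma contDiff_exp_mul_conj (lam : ℂ) :
    ContDiff ℝ (⊤ : ℕ∞) (fun y => Complex.exp (lam * (starRingEnd ℂ) y)) :=
  (contDiff_const.mul (Complex.conjCLE : ℂ →L[ℝ] ℂ).contDiff).cexp

lemma dbar_exp_mul_conj (lam z : ℂ) :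
    dbar (fun y => Complex.exp (lam * (starRingEnd ℂ) y)) z
      = lam * Complex.exp (lam * (starRingEnd ℂ) z) := by
  simp only [dbar, (hasFDerivAt_exp_mul_conj lam z).fderiv]
  simp
  linear_combination (-1 / 2 : ℂ) * Complex.exp (lam * (starRingEnd ℂ) z) * lam * Complex.I_mul_I

lemma dz_exp_mul_conj (lam z : ℂ) :
    dz (fun y => Complex.exp (lam * (starRingEnd ℂ) y)) z = 0 := by
  simp only [dz, (hasFDerivAt_exp_mul_conj lam z).fderiv]
  simp
  linear_combination Complex.exp (lam * (starRingEnd ℂ) z) * lam * Complex.I_mul_I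

lemma dbar_id_mul {u : ℂ → ℂ} {z : ℂ} (hu : DifferentiableAt ℝ u z) :
    dbar (fun y => y * u y) z = z * dbar u z := by
  rw [dbar_mul differentiableAt_fun_id hu]
  simp [dbar]

lemma dz_id_mul {u : ℂ → ℂ} {z : ℂ} (hu : DifferentiableAt ℝ u z) :
    dz (fun y => y * u y) z = u z + z * dz u z := by
  simp only [dz, fderiv_fun_mul differentiableAt_fun_id hu, add_apply,
    smul_apply, smul_eq_mul, fderiv_fun_id, ContinuousLinearMap.id_apply]
  linear_combination (-1 / 2 : ℂ) * u z * Complex.I_mul_I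

/-- for `λ ∈ ℂ`, `X ⊆ ℂ` open and smooth `w : X → ℂ`, `ψ : X → X`, the weighted
composition operator `f ↦ w·(f∘ψ)` preserves the eigenspace `{f : ∂_z̄ f = λf}` iff
`w·∂_z̄ψ = 0` and `∂_z̄w − λw = −λ·w·∂_z̄ψ̄` on `X`; and in that case, for every open `Y ⊆ X` and
smooth `f : Y → ℂ` one has `∂_z̄(w·(f∘ψ)) − λ·w·(f∘ψ) = ∂_z̄ψ̄ · w·((∂_z̄f − λf)∘ψ)` on `ψ⁻¹(Y)`. -/
theorem stmt13 (lam : ℂ) (X : Set ℂ) (hX : IsOpen X)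
    (w ψ : ℂ → ℂ)
    (hw : ContDiffOn ℝ (⊤ : ℕ∞) w X) (hψ : ContDiffOn ℝ (⊤ : ℕ∞) ψ X)
    (hm : Set.MapsTo ψ X X) :
    ((∀ f : ℂ → ℂ, ContDiffOn ℝ (⊤ : ℕ∞) f X → (∀ z ∈ X, dbar f z = lam * f z) →
        ∀ z ∈ X, dbar (fun y => w y * f (ψ y)) z = lam * (w z * f (ψ z))) ↔
      (∀ z ∈ X, w z * dbar ψ z = 0 ∧
        dbar w z - lam * w z = -lam * w z * dbar (fun y => (starRingEnd ℂ) (ψ y)) z)) ∧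
    ((∀ f : ℂ → ℂ, ContDiffOn ℝ (⊤ : ℕ∞) f X → (∀ z ∈ X, dbar f z = lam * f z) →
        ∀ z ∈ X, dbar (fun y => w y * f (ψ y)) z = lam * (w z * f (ψ z))) →
      ∀ Y : Set ℂ, IsOpen Y → Y ⊆ X → ∀ f : ℂ → ℂ, ContDiffOn ℝ (⊤ : ℕ∞) f Y →
        ∀ z ∈ X, ψ z ∈ Y →
          dbar (fun y => w y * f (ψ y)) z - lam * (w z * f (ψ z))
            = dbar (fun y => (starRingEnd ℂ) (ψ y)) z *
                (w z * (dbar f (ψ z) - lam * f (ψ z)))) := by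
  have dw : ∀ z ∈ X, DifferentiableAt ℝ w z := fun z hz =>
    (hw.contDiffAt (hX.mem_nhds hz)).differentiableAt (by simp)
  have dψ : ∀ z ∈ X, DifferentiableAt ℝ ψ z := fun z hz =>
    (hψ.contDiffAt (hX.mem_nhds hz)).differentiableAt (by simp)
  have necessary : (∀ f : ℂ → ℂ, ContDiffOn ℝ (⊤ : ℕ∞) f X →
        (∀ z ∈ X, dbar f z = lam * f z) →
        ∀ z ∈ X, dbar (fun y => w y * f (ψ y)) z = lam * (w z * f (ψ z))) →
      ∀ z ∈ X, w z * dbar ψ z = 0 ∧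
        dbar w z - lam * w z = -lam * w z * dbar (fun y => (starRingEnd ℂ) (ψ y)) z := by
    intro h z hz
    set e : ℂ → ℂ := fun y => Complex.exp (lam * (starRingEnd ℂ) y)
    have ce : ContDiff ℝ (⊤ : ℕ∞) e := contDiff_exp_mul_conj lam
    have de : Differentiable ℝ e := ce.differentiable (by simp)
    have e_ne : e (ψ z) ≠ 0 := Complex.exp_ne_zero _
    have bar_e : ∀ y, dbar e y = lam * e y := dbar_exp_mul_conj lam
    have bar_id_e : ∀ y, dbar (fun x => x * e x) y = lam * (y * e y) := fun y => by
      rw [dbar_id_mul (de y), bar_e]; ring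
    have h₁ := h e ce.contDiffOn (fun y _ => bar_e y) z hz
    have h₂ := h (fun y => y * e y) (contDiff_id.mul ce).contDiffOn (fun y _ => bar_id_e y) z hz
    rw [dbar_mul_comp (dw z hz) (de _) (dψ z hz), bar_e, dz_exp_mul_conj] at h₁
    rw [dbar_mul_comp (f := fun y => y * e y) (dw z hz) (differentiableAt_fun_id.mul (de _))
      (dψ z hz), bar_id_e, dz_id_mul (de _), dz_exp_mul_conj] at h₂
    constructor <;> apply mul_right_cancel₀ e_ne
    · linear_combination h₂ - ψ z * h₁
    · linear_combination h₁
  refine ⟨⟨necessary, fun h f hf hfe z hz => ?_⟩, fun h Y hY _ f hf z hz hzY => ?_⟩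
  · have df := (hf.contDiffAt (hX.mem_nhds (hm hz))).differentiableAt (by simp)
    have key := dbar_mul_comp_sub (dw z hz) df (dψ z hz) (h z hz).1 (h z hz).2
    rw [hfe _ (hm hz), sub_self, mul_zero, mul_zero] at key
    exact sub_eq_zero.mp key
  · have df := (hf.contDiffAt (hY.mem_nhds hzY)).differentiableAt (by simp)
    obtain ⟨h₁, h₂⟩ := necessary h z hz
    exact dbar_mul_comp_sub (dw z hz) df (dψ z hz) h₁ h₂
end

section
/- Let d ≥ 2, λ ∈ ℂ, let X ⊆ ℝ^d be open, and let w : X → ℂ and ψ : X → X be smooth, with components ψ₁, …, ψ_d : X → ℝ. Then the following are equivalent: (i) for every smooth f : X → ℂ with Δf = λ f on X, the function w·(f∘ψ) also satisfies Δ(w·(f∘ψ)) = λ·w·(f∘ψ) on X; (ii) for all 1 ≤ j ≠ k ≤ d one has w·|∇ψ_j|² = w·|∇ψ_k|² and w·⟨∇ψ_j, ∇ψ_k⟩ = 0 on X, for all 1 ≤ j ≤ d one has w·Δψ_j + 2⟨∇w, ∇ψ_j⟩ = 0 on X, and Δw − λ w = −λ·w·|∇ψ₁|² on X. Moreover, if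 (i) holds, then for every open Y ⊆ X and every smooth f : Y → ℂ one has, on ψ^{-1}(Y): Δ(w·(f∘ψ)) − λ·w·(f∘ψ) = |∇ψ₁|² · w·((Δf − λ f)∘ψ). -/
/-- The `j`-th partial derivative of a function on `ℝ^d` with values in a real normed space. -/
noncomputable def pd {d : ℕ} {F : Type*} [NormedAddCommGroup F] [NormedSpace ℝ F]
    (j : Fin d) (f : EuclideanSpace ℝ (Fin d) → F) : EuclideanSpace ℝ (Fin d) → F :=
  fun x => fderiv ℝ f x (EuclideanSpace.single j 1)

/-- The Laplacian `Δf = ∑ⱼ ∂ⱼ²f` of a function on `ℝ^d`. -/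
noncomputable def lap {d : ℕ} {F : Type*} [NormedAddCommGroup F] [NormedSpace ℝ F]
    (f : EuclideanSpace ℝ (Fin d) → F) : EuclideanSpace ℝ (Fin d) → F :=
  fun x => ∑ j, pd j (pd j f) x

/-- `|∇f|² = ⟨∇f, ∇f⟩` for a real-valued function on `ℝ^d`. -/
noncomputable def gradSq {d : ℕ} (f : EuclideanSpace ℝ (Fin d) → ℝ)
    (x : EuclideanSpace ℝ (Fin d)) : ℝ :=
  ∑ l, pd l f x * pd l f x

/-- The bilinear pairing `⟨∇f, ∇g⟩ = ∑ₗ (∂ₗf)(∂ₗg)` of gradients of real-valued functions. -/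
noncomputable def gradPair {d : ℕ} (f g : EuclideanSpace ℝ (Fin d) → ℝ)
    (x : EuclideanSpace ℝ (Fin d)) : ℝ :=
  ∑ l, pd l f x * pd l g x

/-- The bilinear pairing `⟨∇w, ∇g⟩ = ∑ₗ (∂ₗw)(∂ₗg)` with `w` complex-valued, `g` real-valued. -/
noncomputable def gradPairC {d : ℕ} (w : EuclideanSpace ℝ (Fin d) → ℂ)
    (g : EuclideanSpace ℝ (Fin d) → ℝ) (x : EuclideanSpace ℝ (Fin d)) : ℂ :=
  ∑ l, pd l w x * ((pd l g x : ℝ) : ℂ)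

open Filter Topology

section PartialDerivatives

variable {d : ℕ}

lemma pd_congr {F : Type*} [NormedAddCommGroup F] [NormedSpace ℝ F]
    {f g : EuclideanSpace ℝ (Fin d) → F} {x : EuclideanSpace ℝ (Fin d)}
    (h : f =ᶠ[𝓝 x] g) (l : Fin d) : pd l f x = pd l g x := by
  simp only [pd, h.fderiv_eq]

lemma ContDiffAt.differentiableAt_pd {F : Type*} [NormedAddCommGroup F] [NormedSpace ℝ F]
    {f : EuclideanSpace ℝ (Fin d) → F} {x : EuclideanSpace ℝ (Fin d)}
    (hf : ContDiffAt ℝ 2 f x) (l : Fin d) : DifferentiableAt ℝ (pd l f) x := by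
  have h : ContDiffAt ℝ 1 (fderiv ℝ f) x := hf.fderiv_right (by norm_num)
  exact (h.differentiableAt (by norm_num)).clm_apply (differentiableAt_const _)

lemma pd_add {u v : EuclideanSpace ℝ (Fin d) → ℂ} {x : EuclideanSpace ℝ (Fin d)}
    (hu : DifferentiableAt ℝ u x) (hv : DifferentiableAt ℝ v x) (l : Fin d) :
    pd l (fun y => u y + v y) x = pd l u x + pd l v x := by
  simp [pd, fderiv_fun_add hu hv]

lemma pd_mul {u v : EuclideanSpace ℝ (Fin d) → ℂ} {x : EuclideanSpace ℝ (Fin d)}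
    (hu : DifferentiableAt ℝ u x) (hv : DifferentiableAt ℝ v x) (l : Fin d) :
    pd l (fun y => u y * v y) x = pd l u x * v x + u x * pd l v x := by
  simp only [pd, fderiv_fun_mul hu hv]
  simp
  ring

lemma pd_sum {ι : Type*} {s : Finset ι} {u : ι → EuclideanSpace ℝ (Fin d) → ℂ}
    {x : EuclideanSpace ℝ (Fin d)} (hu : ∀ i ∈ s, DifferentiableAt ℝ (u i) x) (l : Fin d) :
    pd l (fun y => ∑ i ∈ s, u i y) x = ∑ i ∈ s, pd l (u i) x := by
  simp [pd, fderiv_fun_sum hu]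

lemma DifferentiableAt.complex_ofReal {g : EuclideanSpace ℝ (Fin d) → ℝ}
    {x : EuclideanSpace ℝ (Fin d)} (hg : DifferentiableAt ℝ g x) :
    DifferentiableAt ℝ (fun y => (g y : ℂ)) x :=
  Complex.ofRealCLM.differentiableAt.comp x hg

lemma pd_ofReal {g : EuclideanSpace ℝ (Fin d) → ℝ} {x : EuclideanSpace ℝ (Fin d)}
    (hg : DifferentiableAt ℝ g x) (l : Fin d) :
    pd l (fun y => (g y : ℂ)) x = ((pd l g x : ℝ) : ℂ) := by
  have h := (Complex.ofRealCLM.hasFDerivAt.comp x hg.hasFDerivAt).fderiv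
  simp only [pd]
  change fderiv ℝ (Complex.ofRealCLM ∘ g) x _ = _
  rw [h]
  simp

lemma lap_ofReal {g : EuclideanSpace ℝ (Fin d) → ℝ} {x : EuclideanSpace ℝ (Fin d)}
    (hg : ContDiffAt ℝ 2 g x) : lap (fun y => (g y : ℂ)) x = ((lap g x : ℝ) : ℂ) := by
  simp only [lap, Complex.ofReal_sum]
  refine Finset.sum_congr rfl fun l _ => ?_
  rw [← pd_ofReal (hg.differentiableAt_pd l)]
  refine pd_congr ?_ l
  filter_upwards [hg.eventually (by simp)] with z hz
  exact pd_ofReal (hz.differentiableAt (by norm_num)) l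

lemma pd_comp {f : EuclideanSpace ℝ (Fin d) → ℂ}
    {ψ : EuclideanSpace ℝ (Fin d) → EuclideanSpace ℝ (Fin d)} {x : EuclideanSpace ℝ (Fin d)}
    (hf : DifferentiableAt ℝ f (ψ x)) (hψ : DifferentiableAt ℝ ψ x) (l : Fin d) :
    pd l (fun y => f (ψ y)) x
      = ∑ j, ((pd l (fun y => (ψ y) j) x : ℝ) : ℂ) * pd j f (ψ x) := by
  have hcoord (j : Fin d) :
      pd l (fun y => (ψ y) j) x = (fderiv ℝ ψ x (EuclideanSpace.single l 1)) j := by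
    have h := ((EuclideanSpace.proj (𝕜 := ℝ) j).hasFDerivAt.comp x hψ.hasFDerivAt).fderiv
    simp only [pd]
    change fderiv ℝ ((EuclideanSpace.proj (𝕜 := ℝ) j) ∘ ψ) x _ = _
    rw [h]
    rfl
  have hsum (v : EuclideanSpace ℝ (Fin d)) :
      v = ∑ j, v j • EuclideanSpace.single j (1 : ℝ) := by
    ext i
    simp [Finset.sum_apply, Pi.single_apply]
  have h := (hf.hasFDerivAt.comp x hψ.hasFDerivAt).fderiv
  simp only [hcoord]
  simp only [pd]
  change fderiv ℝ (f ∘ ψ) x _ = _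
  rw [h, ContinuousLinearMap.comp_apply]
  conv_lhs => rw [hsum (fderiv ℝ ψ x (EuclideanSpace.single l 1))]
  simp [map_sum]

lemma ContDiffAt.euclidean_coord {n : WithTop ℕ∞}
    {ψ : EuclideanSpace ℝ (Fin d) → EuclideanSpace ℝ (Fin d)} {x : EuclideanSpace ℝ (Fin d)}
    (hψ : ContDiffAt ℝ n ψ x) (j : Fin d) : ContDiffAt ℝ n (fun y => (ψ y) j) x :=
  (EuclideanSpace.proj (𝕜 := ℝ) j).contDiff.contDiffAt.comp x hψ

end PartialDerivatives

section WeightedComposition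

variable {d : ℕ} {w f : EuclideanSpace ℝ (Fin d) → ℂ}
  {ψ : EuclideanSpace ℝ (Fin d) → EuclideanSpace ℝ (Fin d)} {x : EuclideanSpace ℝ (Fin d)}

lemma pd_mul_comp (hw : DifferentiableAt ℝ w x) (hψ : DifferentiableAt ℝ ψ x)
    (hf : DifferentiableAt ℝ f (ψ x)) (l : Fin d) :
    pd l (fun y => w y * f (ψ y)) x = pd l w x * f (ψ x)
      + ∑ j, (w x * ((pd l (fun y => (ψ y) j) x : ℝ) : ℂ)) * pd j f (ψ x) := by
  have hfψ : DifferentiableAt ℝ (fun y => f (ψ y)) x := hf.comp x hψ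
  rw [pd_mul hw hfψ, pd_comp hf hψ, Finset.mul_sum]
  simp only [mul_assoc]

lemma pd_pd_mul_comp (hw : ContDiffAt ℝ 2 w x) (hψ : ContDiffAt ℝ 2 ψ x)
    (hf : ContDiffAt ℝ 2 f (ψ x)) (l : Fin d) :
    pd l (pd l (fun y => w y * f (ψ y))) x = pd l (pd l w) x * f (ψ x)
      + ∑ j, (w x * ((pd l (pd l (fun y => (ψ y) j)) x : ℝ) : ℂ)
          + 2 * (pd l w x * ((pd l (fun y => (ψ y) j) x : ℝ) : ℂ))) * pd j f (ψ x)
      + ∑ j, ∑ k, w x * (((pd l (fun y => (ψ y) j) x : ℝ) : ℂ)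
          * ((pd l (fun y => (ψ y) k) x : ℝ) : ℂ))
          * pd k (pd j f) (ψ x) := by
  have two_ne : (2 : WithTop ℕ∞) ≠ 0 := by norm_num
  have hw1 := hw.differentiableAt two_ne
  have hψ1 := hψ.differentiableAt two_ne
  have hf1 := hf.differentiableAt two_ne
  have hfst : pd l (fun y => w y * f (ψ y)) =ᶠ[𝓝 x] fun z => pd l w z * f (ψ z)
      + ∑ j, (w z * ((pd l (fun y => (ψ y) j) z : ℝ) : ℂ)) * pd j f (ψ z) := by
    filter_upwards [hw.eventually (by simp), hψ.eventually (by simp),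
      hψ.continuousAt.eventually (hf.eventually (by simp))] with z hwz hψz hfz
    exact pd_mul_comp (hwz.differentiableAt two_ne) (hψz.differentiableAt two_ne)
      (hfz.differentiableAt two_ne) l
  have hcoord (j : Fin d) : DifferentiableAt ℝ (pd l (fun y => (ψ y) j)) x :=
    (hψ.euclidean_coord j).differentiableAt_pd l
  have hwcoord (j : Fin d) :
      DifferentiableAt ℝ (fun z => w z * ((pd l (fun y => (ψ y) j) z : ℝ) : ℂ)) x :=
    hw1.mul (hcoord j).complex_ofReal
  have hterm (j : Fin d) : DifferentiableAt ℝ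
      (fun z => (w z * ((pd l (fun y => (ψ y) j) z : ℝ) : ℂ)) * pd j f (ψ z)) x :=
    (hwcoord j).mul ((hf.differentiableAt_pd j).comp x hψ1)
  have hzeroth : DifferentiableAt ℝ (fun z => pd l w z * f (ψ z)) x :=
    (hw.differentiableAt_pd l).mul (hf1.comp x hψ1)
  rw [pd_congr hfst, pd_add hzeroth
    (DifferentiableAt.fun_sum fun j _ => hterm j), pd_mul_comp (hw.differentiableAt_pd l) hψ1 hf1,
    pd_sum fun j _ => hterm j, add_assoc, add_assoc, ← Finset.sum_add_distrib,
    ← Finset.sum_add_distrib]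
  congr 1
  refine Finset.sum_congr rfl fun j _ => ?_
  rw [pd_mul_comp (hwcoord j) hψ1 (hf.differentiableAt_pd j), pd_mul hw1 (hcoord j).complex_ofReal,
    pd_ofReal (hcoord j), ← add_assoc]
  congr 1
  · ring
  · exact Finset.sum_congr rfl fun k _ => by ring

lemma lap_mul_comp (hw : ContDiffAt ℝ 2 w x) (hψ : ContDiffAt ℝ 2 ψ x)
    (hf : ContDiffAt ℝ 2 f (ψ x)) :
    lap (fun y => w y * f (ψ y)) x = lap w x * f (ψ x)
      + ∑ j, (w x * (lap (fun y => (ψ y) j) x : ℂ)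
          + 2 * gradPairC w (fun y => (ψ y) j) x) * pd j f (ψ x)
      + ∑ j, ∑ k, w x * (gradPair (fun y => (ψ y) j) (fun y => (ψ y) k) x : ℂ)
          * pd k (pd j f) (ψ x) := by
  have hsnd : ∑ l, ∑ j, ∑ k, w x * (((pd l (fun y => (ψ y) j) x : ℝ) : ℂ)
        * ((pd l (fun y => (ψ y) k) x : ℝ) : ℂ)) * pd k (pd j f) (ψ x)
      = ∑ j, ∑ k, w x * (gradPair (fun y => (ψ y) j) (fun y => (ψ y) k) x : ℂ)
          * pd k (pd j f) (ψ x) := by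
    rw [Finset.sum_comm]
    refine Finset.sum_congr rfl fun j _ => ?_
    rw [Finset.sum_comm]
    refine Finset.sum_congr rfl fun k _ => ?_
    simp only [gradPair, Complex.ofReal_sum, Complex.ofReal_mul, Finset.mul_sum, Finset.sum_mul]
  have hfst : ∑ l, ∑ j, (w x * ((pd l (pd l (fun y => (ψ y) j)) x : ℝ) : ℂ)
          + 2 * (pd l w x * ((pd l (fun y => (ψ y) j) x : ℝ) : ℂ))) * pd j f (ψ x)
      = ∑ j, (w x * (lap (fun y => (ψ y) j) x : ℂ)
          + 2 * gradPairC w (fun y => (ψ y) j) x) * pd j f (ψ x) := by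
    rw [Finset.sum_comm]
    refine Finset.sum_congr rfl fun j _ => ?_
    rw [lap_ofReal (hψ.euclidean_coord j)]
    simp only [lap, gradPairC, Complex.ofReal_sum, Finset.mul_sum, ← Finset.sum_add_distrib,
      Finset.sum_mul]
  rw [← hsnd, ← hfst]
  conv_lhs => rw [lap]
  simp only [pd_pd_mul_comp hw hψ hf, Finset.sum_add_distrib, lap, Finset.sum_mul]

lemma lap_mul_comp_sub (i : Fin d) (lam : ℂ) (hw : ContDiffAt ℝ 2 w x) (hψ : ContDiffAt ℝ 2 ψ x)
    (hf : ContDiffAt ℝ 2 f (ψ x))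
    (hconf : ∀ j k : Fin d, j ≠ k →
      w x * (gradSq (fun y => (ψ y) j) x : ℂ) = w x * (gradSq (fun y => (ψ y) k) x : ℂ) ∧
      w x * (gradPair (fun y => (ψ y) j) (fun y => (ψ y) k) x : ℂ) = 0)
    (hgrad : ∀ j : Fin d,
      w x * (lap (fun y => (ψ y) j) x : ℂ) + 2 * gradPairC w (fun y => (ψ y) j) x = 0)
    (hlap : lap w x - lam * w x = -lam * w x * (gradSq (fun y => (ψ y) i) x : ℂ)) :
    lap (fun y => w y * f (ψ y)) x - lam * (w x * f (ψ x))
      = (gradSq (fun y => (ψ y) i) x : ℂ) * (w x * (lap f (ψ x) - lam * f (ψ x))) := by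
  have hsq (j : Fin d) :
      w x * (gradPair (fun y => (ψ y) j) (fun y => (ψ y) j) x : ℂ)
        = w x * (gradSq (fun y => (ψ y) i) x : ℂ) := by
    by_cases h : j = i
    · subst h; rfl
    · exact (hconf j i h).1
  have hsnd : ∑ j, ∑ k, w x * (gradPair (fun y => (ψ y) j) (fun y => (ψ y) k) x : ℂ)
        * pd k (pd j f) (ψ x) = w x * (gradSq (fun y => (ψ y) i) x : ℂ) * lap f (ψ x) := by
    rw [lap, Finset.mul_sum]
    refine Finset.sum_congr rfl fun j _ => ?_
    rw [Finset.sum_eq_single j, hsq]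
    · intro k _ hk
      rw [(hconf j k hk.symm).2, zero_mul]
    · simp
  rw [lap_mul_comp hw hψ hf, hsnd]
  simp only [hgrad, zero_mul, Finset.sum_const_zero, add_zero]
  linear_combination f (ψ x) * hlap

end WeightedComposition

section Exponentials

variable {d : ℕ}

lemma pd_cexp_clm (L : EuclideanSpace ℝ (Fin d) →L[ℝ] ℂ) (k : Fin d) :
    pd k (fun y => Complex.exp (L y))
      = fun y => L (EuclideanSpace.single k 1) * Complex.exp (L y) := by
  funext y
  simp only [pd, (L.hasFDerivAt (x := y)).cexp.fderiv]
  simp [mul_comm]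

lemma pd_pd_cexp_clm (L : EuclideanSpace ℝ (Fin d) →L[ℝ] ℂ) (k l : Fin d)
    (y : EuclideanSpace ℝ (Fin d)) :
    pd k (pd l (fun y => Complex.exp (L y))) y
      = L (EuclideanSpace.single l 1) * L (EuclideanSpace.single k 1) * Complex.exp (L y) := by
  have hdiff : DifferentiableAt ℝ (fun y => Complex.exp (L y)) y := L.differentiableAt.cexp
  rw [pd_cexp_clm, pd_mul (differentiableAt_const _) hdiff, pd_cexp_clm]
  simp [pd, mul_assoc]

/-- The real-linear functional `y ↦ a yᵢ + b yⱼ` with complex coefficients. -/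
noncomputable def twoCoord (i j : Fin d) (a b : ℂ) : EuclideanSpace ℝ (Fin d) →L[ℝ] ℂ :=
  (EuclideanSpace.proj (𝕜 := ℝ) i : EuclideanSpace ℝ (Fin d) →L[ℝ] ℝ).smulRight a
    + (EuclideanSpace.proj (𝕜 := ℝ) j : EuclideanSpace ℝ (Fin d) →L[ℝ] ℝ).smulRight b

lemma twoCoord_single (i j : Fin d) (a b : ℂ) (k : Fin d) :
    twoCoord i j a b (EuclideanSpace.single k 1)
      = (if i = k then a else 0) + (if j = k then b else 0) := by
  simp [twoCoord]

end Exponentials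

/-- A quadratic polynomial vanishing on the conic `a² + b² = lam` is a multiple of its equation. -/
lemma coeff_eq_of_vanish_on_conic {lam A B₁ B₂ C₁₁ C₁₂ C₂₂ : ℂ}
    (h : ∀ a b : ℂ, a ^ 2 + b ^ 2 = lam →
      A + (B₁ * a + B₂ * b) + (C₁₁ * a ^ 2 + 2 * C₁₂ * (a * b) + C₂₂ * b ^ 2) = 0) :
    B₁ = 0 ∧ C₁₁ = C₂₂ ∧ C₁₂ = 0 ∧ A = -lam * C₁₁ := by
  have hI : Complex.I ^ 2 = -1 := Complex.I_sq
  have hpar (e s t : ℂ) (he : e ^ 2 = -1) (hst : s * t = 1) :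
      A + (B₁ * ((s + lam * t) / 2) + B₂ * (-e * (s - lam * t) / 2))
        + (C₁₁ * ((s + lam * t) / 2) ^ 2
          + 2 * C₁₂ * (((s + lam * t) / 2) * (-e * (s - lam * t) / 2))
          + C₂₂ * (-e * (s - lam * t) / 2) ^ 2) = 0 := by
    apply h
    linear_combination ((s - lam * t) ^ 2 / 4) * he + lam * hst
  have hlaurent (p₂ p₁ p₀ q₁ q₂ : ℂ)
      (hp : ∀ s t : ℂ, s * t = 1 → p₂ * s ^ 2 + p₁ * s + p₀ + q₁ * t + q₂ * t ^ 2 = 0) :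
      p₂ = 0 ∧ p₁ = 0 ∧ p₀ = 0 := by
    have e₁ := hp 1 1 (by norm_num)
    have e₂ := hp (-1) (-1) (by norm_num)
    have e₃ := hp 2 (1 / 2) (by norm_num)
    have e₄ := hp (-2) (-1 / 2) (by norm_num)
    have e₅ := hp Complex.I (-Complex.I) (by linear_combination -hI)
    have e₆ := hp (-Complex.I) Complex.I (by linear_combination -hI)
    have hp₀ : p₀ = 0 := by
      linear_combination (e₁ + e₂ + e₅ + e₆) / 4 - (p₂ + q₂) / 2 * hI
    refine ⟨?_, ?_, hp₀⟩
    · linear_combination (2 / 15) * (e₃ + e₄) - (1 / 30) * (e₁ + e₂) - (1 / 5) * hp₀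
    · linear_combination (1 / 3) * (e₃ - e₄) - (1 / 6) * (e₁ - e₂)
  have hcoef (e : ℂ) (he : e ^ 2 = -1) :=
    hlaurent (C₁₁ / 4 - e * C₁₂ / 2 - C₂₂ / 4) (B₁ / 2 - e * B₂ / 2)
      (A + lam * (C₁₁ + C₂₂) / 2) (lam * (B₁ / 2 + e * B₂ / 2))
      (lam ^ 2 * (C₁₁ / 4 + e * C₁₂ / 2 - C₂₂ / 4)) (fun s t hst => by
        linear_combination hpar e s t he hst - C₂₂ * (s - lam * t) ^ 2 / 4 * he
          - lam * (C₁₁ + C₂₂) / 2 * hst)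
  obtain ⟨u₂, u₁, u₀⟩ := hcoef Complex.I hI
  obtain ⟨v₂, v₁, -⟩ := hcoef (-Complex.I) (by linear_combination hI)
  have hC : C₁₁ = C₂₂ := by linear_combination 2 * u₂ + 2 * v₂
  refine ⟨by linear_combination u₁ + v₁, hC, ?_, by linear_combination u₀ + lam / 2 * hC⟩
  linear_combination Complex.I * (u₂ - v₂) + C₁₂ * hI

lemma coeff_eq_of_preserves_eigenfunctions {d : ℕ} {lam : ℂ}
    {w : EuclideanSpace ℝ (Fin d) → ℂ}
    {ψ : EuclideanSpace ℝ (Fin d) → EuclideanSpace ℝ (Fin d)} {x : EuclideanSpace ℝ (Fin d)}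
    (hw : ContDiffAt ℝ 2 w x) (hψ : ContDiffAt ℝ 2 ψ x)
    (h : ∀ f : EuclideanSpace ℝ (Fin d) → ℂ, ContDiff ℝ (⊤ : ℕ∞) f →
      (∀ y, lap f y = lam * f y) →
      lap (fun y => w y * f (ψ y)) x = lam * (w x * f (ψ x)))
    {i j : Fin d} (hij : i ≠ j) :
    w x * (lap (fun y => (ψ y) i) x : ℂ) + 2 * gradPairC w (fun y => (ψ y) i) x = 0 ∧
    w x * (gradSq (fun y => (ψ y) i) x : ℂ) = w x * (gradSq (fun y => (ψ y) j) x : ℂ) ∧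
    w x * (gradPair (fun y => (ψ y) i) (fun y => (ψ y) j) x : ℂ) = 0 ∧
    lap w x - lam * w x = -lam * (w x * (gradSq (fun y => (ψ y) i) x : ℂ)) := by
  refine coeff_eq_of_vanish_on_conic
    (B₂ := w x * (lap (fun y => (ψ y) j) x : ℂ) + 2 * gradPairC w (fun y => (ψ y) j) x)
    fun a b hab => ?_
  have hsymm : gradPair (fun y => (ψ y) j) (fun y => (ψ y) i) x
      = gradPair (fun y => (ψ y) i) (fun y => (ψ y) j) x := by
    simp only [gradPair, mul_comm]
  have hsmooth : ContDiff ℝ (⊤ : ℕ∞) (fun y => Complex.exp (twoCoord i j a b y)) :=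
    (twoCoord i j a b).contDiff.cexp
  have hf := h _ hsmooth fun y => by
    simp only [lap, pd_pd_cexp_clm, ← Finset.sum_mul, twoCoord_single]
    congr 1
    simp [mul_add, add_mul, Finset.sum_add_distrib, hij, hij.symm, ← hab]
    ring
  rw [lap_mul_comp hw hψ
    (hsmooth.contDiffAt.of_le (WithTop.coe_le_coe.mpr (le_top : (2 : ℕ∞) ≤ ⊤)))] at hf
  simp only [pd_pd_cexp_clm] at hf
  simp only [pd_cexp_clm, twoCoord_single] at hf
  simp only [← mul_assoc, ← Finset.sum_mul, ← add_mul] at hf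
  replace hf := mul_right_cancel₀ (Complex.exp_ne_zero _) hf
  simp [mul_add, add_mul, Finset.sum_add_distrib, hsymm] at hf
  change _ + _ + (w x * (gradPair (fun y => (ψ y) i) (fun y => (ψ y) i) x : ℂ) * a ^ 2 + _
    + w x * (gradPair (fun y => (ψ y) j) (fun y => (ψ y) j) x : ℂ) * b ^ 2) = 0
  linear_combination hf

/-- for `d ≥ 2`, `λ ∈ ℂ`, `X ⊆ ℝ^d` open and smooth `w : X → ℂ`, `ψ : X → X`,
the weighted composition operator `f ↦ w·(f∘ψ)` preserves `{f : Δf = λf}` iff the system of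
identities (ii) on `w` and the components of `ψ` holds; and in that case
`Δ(w·(f∘ψ)) − λ·w·(f∘ψ) = |∇ψ₁|²·w·((Δf − λf)∘ψ)` on `ψ⁻¹(Y)` for all smooth `f` on open
`Y ⊆ X`. -/
theorem stmt14 (d : ℕ) (hd : 2 ≤ d) (lam : ℂ)
    (X : Set (EuclideanSpace ℝ (Fin d))) (hX : IsOpen X)
    (w : EuclideanSpace ℝ (Fin d) → ℂ)
    (ψ : EuclideanSpace ℝ (Fin d) → EuclideanSpace ℝ (Fin d))
    (hw : ContDiffOn ℝ (⊤ : ℕ∞) w X) (hψ : ContDiffOn ℝ (⊤ : ℕ∞) ψ X)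
    (hm : Set.MapsTo ψ X X) :
    ((∀ f : EuclideanSpace ℝ (Fin d) → ℂ, ContDiffOn ℝ (⊤ : ℕ∞) f X →
        (∀ x ∈ X, lap f x = lam * f x) →
        ∀ x ∈ X, lap (fun y => w y * f (ψ y)) x = lam * (w x * f (ψ x))) ↔
      (∀ x ∈ X,
        (∀ j k : Fin d, j ≠ k →
          w x * (gradSq (fun y => (ψ y) j) x : ℂ) = w x * (gradSq (fun y => (ψ y) k) x : ℂ) ∧
          w x * (gradPair (fun y => (ψ y) j) (fun y => (ψ y) k) x : ℂ) = 0) ∧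
        (∀ j : Fin d,
          w x * (lap (fun y => (ψ y) j) x : ℂ) + 2 * gradPairC w (fun y => (ψ y) j) x = 0) ∧
        lap w x - lam * w x
          = -lam * w x * (gradSq (fun y => (ψ y) (⟨0, by omega⟩ : Fin d)) x : ℂ))) ∧
    ((∀ f : EuclideanSpace ℝ (Fin d) → ℂ, ContDiffOn ℝ (⊤ : ℕ∞) f X →
        (∀ x ∈ X, lap f x = lam * f x) →
        ∀ x ∈ X, lap (fun y => w y * f (ψ y)) x = lam * (w x * f (ψ x))) →
      ∀ Y : Set (EuclideanSpace ℝ (Fin d)), IsOpen Y → Y ⊆ X →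
        ∀ f : EuclideanSpace ℝ (Fin d) → ℂ, ContDiffOn ℝ (⊤ : ℕ∞) f Y →
          ∀ x ∈ X, ψ x ∈ Y →
            lap (fun y => w y * f (ψ y)) x - lam * (w x * f (ψ x))
              = (gradSq (fun y => (ψ y) (⟨0, by omega⟩ : Fin d)) x : ℂ) *
                  (w x * (lap f (ψ x) - lam * f (ψ x)))) := by
  have hw2 {x} (hx : x ∈ X) : ContDiffAt ℝ 2 w x :=
    (hw.contDiffAt (hX.mem_nhds hx)).of_le (WithTop.coe_le_coe.mpr (le_top : (2 : ℕ∞) ≤ ⊤))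
  have hψ2 {x} (hx : x ∈ X) : ContDiffAt ℝ 2 ψ x :=
    (hψ.contDiffAt (hX.mem_nhds hx)).of_le (WithTop.coe_le_coe.mpr (le_top : (2 : ℕ∞) ≤ ⊤))
  have himp : (∀ f : EuclideanSpace ℝ (Fin d) → ℂ, ContDiffOn ℝ (⊤ : ℕ∞) f X →
        (∀ x ∈ X, lap f x = lam * f x) →
        ∀ x ∈ X, lap (fun y => w y * f (ψ y)) x = lam * (w x * f (ψ x))) →
      (∀ x ∈ X,
        (∀ j k : Fin d, j ≠ k →
          w x * (gradSq (fun y => (ψ y) j) x : ℂ) = w x * (gradSq (fun y => (ψ y) k) x : ℂ) ∧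
          w x * (gradPair (fun y => (ψ y) j) (fun y => (ψ y) k) x : ℂ) = 0) ∧
        (∀ j : Fin d,
          w x * (lap (fun y => (ψ y) j) x : ℂ) + 2 * gradPairC w (fun y => (ψ y) j) x = 0) ∧
        lap w x - lam * w x
          = -lam * w x * (gradSq (fun y => (ψ y) (⟨0, by omega⟩ : Fin d)) x : ℂ)) := by
    intro h x hx
    have hcoeff {i j : Fin d} (hij : i ≠ j) :=
      coeff_eq_of_preserves_eigenfunctions (hw2 hx) (hψ2 hx)
        (fun f hf hlap => h f hf.contDiffOn (fun y _ => hlap y) x hx) hij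
    have : Nontrivial (Fin d) := Fin.nontrivial_iff_two_le.mpr hd
    refine ⟨fun j k hjk => ⟨(hcoeff hjk).2.1, (hcoeff hjk).2.2.1⟩, fun j => ?_, ?_⟩
    · obtain ⟨k, hk⟩ := exists_ne j
      exact (hcoeff hk.symm).1
    · obtain ⟨k, hk⟩ := exists_ne (⟨0, by omega⟩ : Fin d)
      rw [mul_assoc]
      exact (hcoeff hk.symm).2.2.2
  have hfC2 {Y : Set (EuclideanSpace ℝ (Fin d))} (hY : IsOpen Y)
      {f : EuclideanSpace ℝ (Fin d) → ℂ} (hf : ContDiffOn ℝ (⊤ : ℕ∞) f Y)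
      {x : EuclideanSpace ℝ (Fin d)} (hx : ψ x ∈ Y) : ContDiffAt ℝ 2 f (ψ x) :=
    (hf.contDiffAt (hY.mem_nhds hx)).of_le (WithTop.coe_le_coe.mpr (le_top : (2 : ℕ∞) ≤ ⊤))
  refine ⟨⟨himp, fun h f hf hlap x hx => ?_⟩, fun h Y hY _ f hf x hx hxY => ?_⟩
  · obtain ⟨hconf, hgrad, hwlap⟩ := h x hx
    have := lap_mul_comp_sub _ lam (hw2 hx) (hψ2 hx) (hfC2 hX hf (hm hx)) hconf hgrad hwlap
    rw [hlap _ (hm hx), sub_self, mul_zero, mul_zero] at this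
    exact sub_eq_zero.mp this
  · obtain ⟨hconf, hgrad, hwlap⟩ := himp h x hx
    exact lap_mul_comp_sub _ lam (hw2 hx) (hψ2 hx) (hfC2 hY hf hxY) hconf hgrad hwlap
end
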